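/- arXiv:1306.6220 — 2 statements merged into one kernel-verified Lean document; each statement's English description precedes it below -/
import Mathlib

section
/- Let λ, μ ∈ (0,1). Then, as k → 1⁻, Θ(λK(k), k)/Θ(μK(k), k) is asymptotically equivalent to (k'/4)^{(μ−λ)(1−(λ+μ)/2)}, i.e. the quotient [Θ(λK(k), k)/Θ(μK(k), k)] / (k'/4)^{(μ−λ)(1−(λ+μ)/2)} tends to 1 as k → 1⁻, where k' = √(1−k²). -/
open Real

/-- Complete elliptic integral of the first kind. -/
noncomputable def EllK (k : ℝ) : ℝ :=
  ∫ θ in (0:ℝ)..(π/2), 1 / Real.sqrt (1 - k^2 * Real.sin θ ^ 2)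

/-- Complete elliptic integral of the second kind. -/
noncomputable def EllE (k : ℝ) : ℝ :=
  ∫ θ in (0:ℝ)..(π/2), Real.sqrt (1 - k^2 * Real.sin θ ^ 2)

/-- Complementary complete elliptic integral `K'(k) = K(√(1-k²))`. -/
noncomputable def EllK' (k : ℝ) : ℝ := EllK (Real.sqrt (1 - k^2))

/-- Complementary elliptic integral of the second kind `E'(k) = E(√(1-k²))`. -/
noncomputable def EllE' (k : ℝ) : ℝ := EllE (Real.sqrt (1 - k^2))

/-- The nome `q = exp(-π K'(k)/K(k))`. -/
noncomputable def nome (k : ℝ) : ℝ := Real.exp (-π * EllK' k / EllK k)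

/-- Jacobi's theta function `Θ(u,k) = 1 + 2 ∑_{n≥1} (-1)^n q^{n²} cos(nπu/K)`. -/
noncomputable def JTheta (u k : ℝ) : ℝ :=
  1 + 2 * ∑' n : ℕ, (-1 : ℝ)^(n+1) * nome k ^ ((n+1)^2) *
    Real.cos (((n:ℝ)+1) * π * u / EllK k)

/-- Jacobi's theta function `H(u,k) = 2 ∑_{n≥0} (-1)^n q^{(n+1/2)²} sin((2n+1)πu/(2K))`. -/
noncomputable def JH (u k : ℝ) : ℝ :=
  2 * ∑' n : ℕ, (-1 : ℝ)^n * nome k ^ ((((n:ℝ) + 1/2)^2)) *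
    Real.sin ((2*(n:ℝ)+1) * π * u / (2 * EllK k))

/-- Jacobi's theta function `H₁(u,k) = 2 ∑_{n≥0} q^{(n+1/2)²} cos((2n+1)πu/(2K))`. -/
noncomputable def JH1 (u k : ℝ) : ℝ :=
  2 * ∑' n : ℕ, nome k ^ ((((n:ℝ) + 1/2)^2)) *
    Real.cos ((2*(n:ℝ)+1) * π * u / (2 * EllK k))

/-- Jacobi's theta function `Θ₁(u,k) = 1 + 2 ∑_{n≥1} q^{n²} cos(nπu/K)`. -/
noncomputable def JTheta1 (u k : ℝ) : ℝ :=
  1 + 2 * ∑' n : ℕ, nome k ^ ((n+1)^2) * Real.cos (((n:ℝ)+1) * π * u / EllK k)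

/-- Jacobi's zeta function `zn(u,k) = Θ_u(u,k)/Θ(u,k)`. -/
noncomputable def zn (u k : ℝ) : ℝ := deriv (fun v => JTheta v k) u / JTheta u k

/-- Jacobi's elliptic sine `sn(u,k) = H(u,k)/(√k Θ(u,k))`. -/
noncomputable def sn (u k : ℝ) : ℝ := JH u k / (Real.sqrt k * JTheta u k)

/-- Jacobi's elliptic cosine `cn(u,k) = √(k'/k) H₁(u,k)/Θ(u,k)`. -/
noncomputable def cn (u k : ℝ) : ℝ :=
  Real.sqrt (Real.sqrt (1 - k^2) / k) * JH1 u k / JTheta u k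

/-- Jacobi's delta amplitude `dn(u,k) = √(k') Θ₁(u,k)/Θ(u,k)`. -/
noncomputable def dn (u k : ℝ) : ℝ :=
  Real.sqrt (Real.sqrt (1 - k^2)) * JTheta1 u k / JTheta u k

open Filter Topology HurwitzZeta

lemma one_sub_sq_mul_sin_sq_pos {k : ℝ} (h0 : 0 ≤ k) (h1 : k < 1) (θ : ℝ) :
    0 < 1 - k ^ 2 * sin θ ^ 2 := by
  have hk : k ^ 2 < 1 := by nlinarith
  nlinarith [sin_sq_le_one θ, sq_nonneg (sin θ), sq_nonneg k]

lemma continuous_inv_sqrt_one_sub_sq_mul_sin_sq {k : ℝ} (h0 : 0 ≤ k) (h1 : k < 1) :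
    Continuous fun θ : ℝ => 1 / √(1 - k ^ 2 * sin θ ^ 2) :=
  continuous_const.div (by fun_prop)
    fun θ => (sqrt_pos.2 (one_sub_sq_mul_sin_sq_pos h0 h1 θ)).ne'

lemma pi_div_two_le_EllK {k : ℝ} (h0 : 0 ≤ k) (h1 : k < 1) : π / 2 ≤ EllK k := by
  have h : ∫ _ in (0 : ℝ)..(π / 2), (1 : ℝ) ≤ EllK k := by
    refine intervalIntegral.integral_mono_on (by positivity) (by simp)
      ((continuous_inv_sqrt_one_sub_sq_mul_sin_sq h0 h1).intervalIntegrable _ _) fun θ _ => ?_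
    rw [le_div_iff₀ (sqrt_pos.2 (one_sub_sq_mul_sin_sq_pos h0 h1 θ)), one_mul]
    exact sqrt_le_one.2 (by nlinarith [mul_nonneg (sq_nonneg k) (sq_nonneg (sin θ))])
  simpa using h

lemma EllK_le {k : ℝ} (h0 : 0 ≤ k) (h1 : k < 1) : EllK k ≤ π / 2 / √(1 - k ^ 2) := by
  have hk : 0 < 1 - k ^ 2 := by nlinarith
  have h : EllK k ≤ ∫ _ in (0 : ℝ)..(π / 2), 1 / √(1 - k ^ 2) := by
    refine intervalIntegral.integral_mono_on (by positivity)
      ((continuous_inv_sqrt_one_sub_sq_mul_sin_sq h0 h1).intervalIntegrable _ _) (by simp)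
      fun θ _ => ?_
    refine one_div_le_one_div_of_le (sqrt_pos.2 hk) (sqrt_le_sqrt ?_)
    nlinarith [sin_sq_le_one θ, sq_nonneg k]
  simpa [div_eq_mul_inv] using h

lemma EllK'_mem_Icc {k : ℝ} (h0 : 0 < k) (h1 : k < 1) :
    EllK' k ∈ Set.Icc (π / 2) (π / 2 / k) := by
  have hk : 0 ≤ 1 - k ^ 2 := by nlinarith
  have hlt : √(1 - k ^ 2) < 1 := by
    rw [sqrt_lt' one_pos]
    nlinarith
  refine ⟨pi_div_two_le_EllK (sqrt_nonneg _) hlt, ?_⟩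
  have h := EllK_le (sqrt_nonneg _) hlt
  rwa [sq_sqrt hk, sub_sub_cancel, sqrt_sq h0.le] at h

lemma arsinh_div_sqrt_one_sub_sq {k : ℝ} (h0 : 0 < k) (h1 : k < 1) :
    arsinh (k / √(1 - k ^ 2)) = (log (1 + k) - log (1 - k)) / 2 := by
  have hk : 0 < 1 - k ^ 2 := by nlinarith
  have hs := sqrt_pos.2 hk
  have h : √(1 + (k / √(1 - k ^ 2)) ^ 2) = 1 / √(1 - k ^ 2) := by
    rw [← sqrt_sq (show 0 ≤ 1 / √(1 - k ^ 2) by positivity), div_pow, div_pow, sq_sqrt hk.le]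
    congr 1
    field_simp
    ring
  rw [arsinh, h, ← add_div, log_div (by positivity) hs.ne', log_sqrt hk.le,
    show 1 - k ^ 2 = (1 + k) * (1 - k) by ring, log_mul (by positivity) (by linarith), add_comm k]
  ring

lemma integral_sin_div_sqrt {k : ℝ} (h0 : 0 < k) (h1 : k < 1) :
    ∫ θ in (0 : ℝ)..(π / 2), sin θ * (1 / √(1 - k ^ 2 * sin θ ^ 2)) =
      (log (1 + k) - log (1 - k)) / 2 / k := by
  have hk : 0 < 1 - k ^ 2 := by nlinarith
  have hs := sqrt_pos.2 hk
  have hderiv (θ : ℝ) : HasDerivAt (fun θ => -arsinh (k * cos θ / √(1 - k ^ 2)) / k)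
      (sin θ * (1 / √(1 - k ^ 2 * sin θ ^ 2))) θ := by
    have hd := (((((hasDerivAt_cos θ).const_mul k).div_const √(1 - k ^ 2)).arsinh).neg).div_const k
    refine hd.congr_deriv ?_
    have h : √(1 + (k * cos θ / √(1 - k ^ 2)) ^ 2) =
        √(1 - k ^ 2 * sin θ ^ 2) / √(1 - k ^ 2) := by
      rw [← sqrt_div' _ hk.le, div_pow, sq_sqrt hk.le]
      congr 1
      field_simp
      rw [sin_sq]
      ring
    have hp := sqrt_pos.2 (one_sub_sq_mul_sin_sq_pos h0.le h1 θ)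
    rw [h, smul_eq_mul]
    field_simp
  rw [intervalIntegral.integral_eq_sub_of_hasDerivAt (fun θ _ => hderiv θ)
    ((continuous_sin.mul
      (continuous_inv_sqrt_one_sub_sq_mul_sin_sq h0.le h1)).intervalIntegrable _ _)]
  simp only [cos_pi_div_two, cos_zero, mul_zero, zero_div, arsinh_zero, mul_one,
    arsinh_div_sqrt_one_sub_sq h0 h1]
  ring

lemma integral_cos_div_one_add_sin :
    ∫ θ in (0 : ℝ)..(π / 2), cos θ / (1 + sin θ) = log 2 := by
  have hpos : ∀ θ ∈ Set.uIcc 0 (π / 2), 0 < 1 + sin θ := fun θ hθ => by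
    rw [Set.uIcc_of_le (by positivity)] at hθ
    linarith [sin_nonneg_of_nonneg_of_le_pi hθ.1 (by linarith [hθ.2, pi_pos])]
  rw [intervalIntegral.integral_eq_sub_of_hasDerivAt
    (fun θ hθ => ((hasDerivAt_sin θ).const_add 1).log (hpos θ hθ).ne')
    (ContinuousOn.intervalIntegrable (ContinuousOn.div (by fun_prop) (by fun_prop)
      fun θ hθ => (hpos θ hθ).ne'))]
  norm_num

lemma eventually_mem_Ioo_nhdsLT_one : ∀ᶠ k : ℝ in 𝓝[<] 1, k ∈ Set.Ioo (0 : ℝ) 1 :=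
  Ioo_mem_nhdsLT zero_lt_one

lemma tendsto_integral_one_sub_sin_div_sqrt :
    Tendsto (fun k => ∫ θ in (0 : ℝ)..(π / 2), (1 - sin θ) * (1 / √(1 - k ^ 2 * sin θ ^ 2)))
      (𝓝[<] 1) (𝓝 (log 2)) := by
  rw [← integral_cos_div_one_add_sin]
  refine intervalIntegral.tendsto_integral_filter_of_dominated_convergence (fun _ => 1) ?_ ?_
    (by simp) ?_
  · filter_upwards [eventually_mem_Ioo_nhdsLT_one] with k hk
    exact (Continuous.mul (by fun_prop)
      (continuous_inv_sqrt_one_sub_sq_mul_sin_sq hk.1.le hk.2)).aestronglyMeasurable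
  · filter_upwards [eventually_mem_Ioo_nhdsLT_one] with k hk
    refine Eventually.of_forall fun θ hθ => ?_
    rw [Set.uIoc_of_le (by positivity)] at hθ
    have hs0 := sin_nonneg_of_nonneg_of_le_pi hθ.1.le (by linarith [hθ.2, pi_pos])
    have hs1 := sin_le_one θ
    have hp := one_sub_sq_mul_sin_sq_pos hk.1.le hk.2 θ
    rw [norm_of_nonneg (mul_nonneg (by linarith) (by positivity)), mul_one_div,
      div_le_one (sqrt_pos.2 hp)]
    refine le_sqrt_of_sq_le ?_
    have hk2 : k ^ 2 ≤ 1 := by nlinarith [hk.1, hk.2]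
    nlinarith [mul_nonneg (sub_nonneg.2 hk2) (sq_nonneg (sin θ)),
      mul_nonneg hs0 (sub_nonneg.2 hs1)]
  · have hne : ∀ᵐ θ : ℝ, θ ≠ π / 2 := by
      simp [MeasureTheory.ae_iff]
    filter_upwards [hne] with θ hθne hθ
    rw [Set.uIoc_of_le (by positivity)] at hθ
    have hc : 0 < cos θ := cos_pos_of_mem_Ioo
      ⟨by linarith [hθ.1, pi_pos], lt_of_le_of_ne hθ.2 hθne⟩
    have hs0 := sin_nonneg_of_nonneg_of_le_pi hθ.1.le (by linarith [hθ.2, pi_pos])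
    have hval : (1 - sin θ) * (1 / √(1 - 1 ^ 2 * sin θ ^ 2)) = cos θ / (1 + sin θ) := by
      rw [one_pow, one_mul, ← cos_sq', sqrt_sq hc.le]
      field_simp
      rw [cos_sq']
      ring
    rw [← hval]
    refine Tendsto.mono_left (ContinuousAt.tendsto ?_) nhdsWithin_le_nhds
    refine ContinuousAt.mul continuousAt_const (ContinuousAt.div continuousAt_const
      (by fun_prop) ?_)
    rw [one_pow, one_mul, ← cos_sq', sqrt_sq hc.le]
    exact hc.ne'

lemma EllK_eq_log_add_integral {k : ℝ} (h0 : 0 < k) (h1 : k < 1) :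
    EllK k = (log (1 + k) - log (1 - k)) / 2 / k +
      ∫ θ in (0 : ℝ)..(π / 2), (1 - sin θ) * (1 / √(1 - k ^ 2 * sin θ ^ 2)) := by
  have hc := continuous_inv_sqrt_one_sub_sq_mul_sin_sq h0.le h1
  rw [← integral_sin_div_sqrt h0 h1, ← intervalIntegral.integral_add, EllK]
  · congr 1
    ext θ
    ring
  · exact (continuous_sin.mul hc).intervalIntegrable _ _
  · exact ((continuous_const.sub continuous_sin).mul hc).intervalIntegrable _ _

lemma log_sqrt_one_sub_sq_div_four {k : ℝ} (h0 : 0 < k) (h1 : k < 1) :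
    log (√(1 - k ^ 2) / 4) = (log (1 + k) + log (1 - k)) / 2 - 2 * log 2 := by
  have hk : 0 < 1 - k ^ 2 := by nlinarith
  rw [log_div (sqrt_pos.2 hk).ne' (by norm_num), log_sqrt hk.le,
    show 1 - k ^ 2 = (1 + k) * (1 - k) by ring, log_mul (by positivity) (by linarith),
    show (4 : ℝ) = 2 ^ 2 by norm_num, log_pow]
  norm_num

lemma tendsto_one_sub_mul_log_one_sub :
    Tendsto (fun k : ℝ => (1 - k) * log (1 - k)) (𝓝[<] 1) (𝓝 0) := by
  have h : Continuous fun k : ℝ => (1 - k) * log (1 - k) :=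
    continuous_mul_log.comp (continuous_const.sub continuous_id)
  simpa using (h.tendsto 1).mono_left nhdsWithin_le_nhds

/-- `K(k) = log (4 / k') + o(1)` as `k → 1⁻`. -/
lemma tendsto_EllK_add_log :
    Tendsto (fun k => EllK k + log (√(1 - k ^ 2) / 4)) (𝓝[<] 1) (𝓝 0) := by
  have hid : Tendsto (fun k : ℝ => k) (𝓝[<] 1) (𝓝 1) := nhdsWithin_le_nhds
  have hlog : Tendsto (fun k : ℝ => log (1 + k)) (𝓝[<] 1) (𝓝 (log (1 + 1))) :=
    (hid.const_add 1).log (by norm_num)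
  have hmain := (((((hid.const_sub 1).mul hlog).sub tendsto_one_sub_mul_log_one_sub).div_const
    2).div hid one_ne_zero).add ((hlog.sub_const (2 * log 2)).add
      tendsto_integral_one_sub_sin_div_sqrt)
  have hval : ((1 - 1) * log (1 + 1) - 0) / 2 / 1 + (log (1 + 1) - 2 * log 2 + log 2) = 0 := by
    norm_num
    ring
  rw [hval] at hmain
  refine hmain.congr' ?_
  filter_upwards [eventually_mem_Ioo_nhdsLT_one] with k hk
  have := hk.1
  rw [EllK_eq_log_add_integral hk.1 hk.2, log_sqrt_one_sub_sq_div_four hk.1 hk.2]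
  simp only [Pi.div_apply]
  field_simp
  ring

lemma tendsto_one_sub_mul_EllK :
    Tendsto (fun k => (1 - k) * EllK k) (𝓝[<] 1) (𝓝 0) := by
  have hid : Tendsto (fun k : ℝ => k) (𝓝[<] 1) (𝓝 1) := nhdsWithin_le_nhds
  have hlog : Tendsto (fun k : ℝ => log (1 + k)) (𝓝[<] 1) (𝓝 (log (1 + 1))) :=
    (hid.const_add 1).log (by norm_num)
  have hmain := ((hid.const_sub 1).mul tendsto_EllK_add_log).sub
    ((((hid.const_sub 1).mul hlog).add tendsto_one_sub_mul_log_one_sub).div_const 2 |>.sub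
      ((hid.const_sub 1).mul_const (2 * log 2)))
  norm_num at hmain
  refine hmain.congr' ?_
  filter_upwards [eventually_mem_Ioo_nhdsLT_one] with k hk
  rw [log_sqrt_one_sub_sq_div_four hk.1 hk.2]
  ring

/-- `π K / (2 K') = log (4 / k') + o(1)` as `k → 1⁻`. -/
lemma tendsto_EllK_div_EllK'_add_log :
    Tendsto (fun k => π / 2 * (EllK k / EllK' k) + log (√(1 - k ^ 2) / 4)) (𝓝[<] 1) (𝓝 0) := by
  have hdiff : Tendsto (fun k => EllK k - π / 2 * (EllK k / EllK' k)) (𝓝[<] 1) (𝓝 0) := by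
    refine squeeze_zero' ?_ ?_ tendsto_one_sub_mul_EllK <;>
    · filter_upwards [eventually_mem_Ioo_nhdsLT_one] with k hk
      obtain ⟨hl, hu⟩ := EllK'_mem_Icc hk.1 hk.2
      have hK := pi_div_two_le_EllK hk.1.le hk.2
      have hpi := pi_pos
      have hK0 : 0 < EllK k := by linarith
      have hK' : 0 < EllK' k := by linarith
      have hr : π / 2 * (EllK k / EllK' k) = EllK k * (π / 2 / EllK' k) := by ring
      have h1 : π / 2 / EllK' k ≤ 1 := (div_le_one hK').2 hl
      have h2 : k ≤ π / 2 / EllK' k := by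
        rw [le_div_iff₀ hK', mul_comm]
        exact (le_div_iff₀ hk.1).1 hu
      rw [hr]
      nlinarith
  simpa using (tendsto_EllK_add_log.sub hdiff).congr fun k => by ring

lemma tendsto_EllK_div_EllK'_atTop :
    Tendsto (fun k => EllK k / EllK' k) (𝓝[<] 1) atTop := by
  have hs : Tendsto (fun k : ℝ => √(1 - k ^ 2) / 4) (𝓝[<] 1) (𝓝[>] 0) := by
    refine tendsto_nhdsWithin_iff.2 ⟨?_, ?_⟩
    · have h : Continuous fun k : ℝ => √(1 - k ^ 2) / 4 := by fun_prop
      simpa using (h.tendsto 1).mono_left nhdsWithin_le_nhds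
    · filter_upwards [eventually_mem_Ioo_nhdsLT_one] with k hk
      have : 0 < 1 - k ^ 2 := by nlinarith [hk.1, hk.2]
      exact div_pos (sqrt_pos.2 this) (by norm_num)
  have h := tendsto_EllK_div_EllK'_add_log.add_atTop
    (tendsto_neg_atBot_atTop.comp (tendsto_log_nhdsGT_zero.comp hs))
  have h' := h.const_mul_atTop (show 0 < 2 / π by positivity)
  refine h'.congr fun k => ?_
  simp only [Function.comp_apply]
  field_simp
  ring

lemma JTheta_mul_EllK_eq_cosKernel (c : ℝ) {k : ℝ} (hK : 0 < EllK k) (hK' : 0 < EllK' k) :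
    JTheta (c * EllK k) k = cosKernel ((c + 1) / 2 : ℝ) (EllK' k / EllK k) := by
  rw [JTheta, ← tsum_mul_left, ← eq_sub_iff_add_eq']
  refine Eq.trans (tsum_congr fun n => ?_)
    (hasSum_nat_cosKernel₀ ((c + 1) / 2) (div_pos hK' hK)).tsum_eq
  have hcos : cos (2 * π * ((c + 1) / 2) * (n + 1)) =
      (-1) ^ (n + 1) * cos ((n + 1) * π * (c * EllK k) / EllK k) := by
    rw [← cos_add_nat_mul_pi]
    congr 1
    push_cast
    field_simp
  have hexp : nome k ^ ((n + 1) ^ 2) = rexp (-π * (n + 1) ^ 2 * (EllK' k / EllK k)) := by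
    rw [nome, ← exp_nat_mul]
    congr 1
    push_cast
    ring
  rw [hcos, hexp]
  ring

lemma tendsto_exp_mul_evenKernel {c : ℝ} (hc : c ∈ Set.Ioo (0 : ℝ) 1) :
    Tendsto (fun s => rexp (π * (1 - c) ^ 2 / 4 * s) * evenKernel ((c + 1) / 2 : ℝ) s)
      atTop (𝓝 1) := by
  have hterm (s : ℝ) (n : ℤ) : rexp (π * (1 - c) ^ 2 / 4 * s) *
      rexp (-π * (n + (c + 1) / 2) ^ 2 * s) = rexp (-(π * ((n + 1) * (n + c)) * s)) := by
    rw [← exp_add]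
    congr 1
    ring
  have hpos {n : ℤ} (hn : n ≠ -1) : 0 < π * (((n : ℝ) + 1) * (n + c)) := by
    refine mul_pos pi_pos ?_
    rcases lt_or_gt_of_ne hn with h | h
    · have : (n : ℝ) ≤ -2 := by exact_mod_cast (show n ≤ -2 by lia)
      exact mul_pos_of_neg_of_neg (by linarith) (by linarith [hc.2])
    · have : (0 : ℝ) ≤ n := by exact_mod_cast (show 0 ≤ n by lia)
      exact mul_pos (by linarith) (by linarith [hc.1])
  have hsum (s : ℝ) (hs : 0 < s) := (hasSum_int_evenKernel ((c + 1) / 2) hs).mul_left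
    (rexp (π * (1 - c) ^ 2 / 4 * s))
  simp only [hterm] at hsum
  have hlim : Tendsto (fun s : ℝ => ∑' n : ℤ, rexp (-(π * (((n : ℝ) + 1) * (n + c)) * s))) atTop
      (𝓝 (∑' n : ℤ, if n = -1 then 1 else 0)) := by
    refine tendsto_tsum_of_dominated_convergence (hsum 1 one_pos).summable (fun n => ?_) ?_
    · split_ifs with hn
      · simp [hn]
      · exact tendsto_exp_neg_atTop_nhds_zero.comp (tendsto_id.const_mul_atTop (hpos hn))
    · filter_upwards [eventually_ge_atTop 1] with s hs n
      rw [norm_of_nonneg (exp_pos _).le, exp_le_exp, neg_le_neg_iff]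
      rcases eq_or_ne n (-1) with rfl | hn
      · simp
      · exact mul_le_mul_of_nonneg_left hs (hpos hn).le
  rw [tsum_ite_eq] at hlim
  refine hlim.congr' ?_
  filter_upwards [eventually_gt_atTop 0] with s hs
  exact (hsum s hs).tsum_eq

lemma cosKernel_eq_evenKernel (a : UnitAddCircle) {t : ℝ} (ht : 0 < t) :
    cosKernel a t = t⁻¹ ^ (1 / 2 : ℝ) * evenKernel a t⁻¹ := by
  have hp : 0 < t⁻¹ ^ (1 / 2 : ℝ) := rpow_pos_of_pos (inv_pos.2 ht) _
  rw [evenKernel_functional_equation, one_div t⁻¹, inv_inv]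
  field_simp

theorem stmt_4 (lam mu : ℝ) (hlam : lam ∈ Set.Ioo (0:ℝ) 1) (hmu : mu ∈ Set.Ioo (0:ℝ) 1) :
    Filter.Tendsto (fun k =>
        (JTheta (lam * EllK k) k / JTheta (mu * EllK k) k) /
          (Real.sqrt (1 - k^2) / 4) ^ ((mu - lam) * (1 - (lam + mu) / 2)))
      (nhdsWithin 1 (Set.Iio (1:ℝ))) (nhds 1) := by
  have hG {c : ℝ} (hc : c ∈ Set.Ioo (0 : ℝ) 1) :=
    (tendsto_exp_mul_evenKernel hc).comp tendsto_EllK_div_EllK'_atTop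
  have hE := (continuous_exp.tendsto _).comp
    (tendsto_EllK_div_EllK'_add_log.const_mul (-((mu - lam) * (1 - (lam + mu) / 2))))
  have hmain := hE.mul ((hG hlam).div (hG hmu) one_ne_zero)
  rw [mul_zero, exp_zero, div_one, mul_one] at hmain
  refine hmain.congr' ?_
  filter_upwards [eventually_mem_Ioo_nhdsLT_one] with k hk
  have hK : 0 < EllK k := (by positivity : 0 < π / 2).trans_le (pi_div_two_le_EllK hk.1.le hk.2)
  have hK' : 0 < EllK' k := (by positivity : 0 < π / 2).trans_le (EllK'_mem_Icc hk.1 hk.2).1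
  have hk2 : 0 < 1 - k ^ 2 := by nlinarith [hk.1, hk.2]
  have ht : 0 < EllK' k / EllK k := div_pos hK' hK
  have hs : 0 < (EllK k / EllK' k) ^ (1 / 2 : ℝ) := rpow_pos_of_pos (div_pos hK hK') _
  rw [JTheta_mul_EllK_eq_cosKernel _ hK hK', JTheta_mul_EllK_eq_cosKernel _ hK hK',
    cosKernel_eq_evenKernel _ ht, cosKernel_eq_evenKernel _ ht, inv_div,
    mul_div_mul_left _ _ hs.ne', rpow_def_of_pos (div_pos (sqrt_pos.2 hk2) (by norm_num))]
  simp only [Function.comp_apply, Pi.div_apply]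
  generalize evenKernel _ _ = A
  generalize evenKernel _ _ = B
  generalize EllK k / EllK' k = s
  generalize log (√(1 - k ^ 2) / 4) = L
  have hexp : rexp (-((mu - lam) * (1 - (lam + mu) / 2)) * (π / 2 * s + L)) *
      rexp (π * (1 - lam) ^ 2 / 4 * s) * rexp (L * ((mu - lam) * (1 - (lam + mu) / 2))) =
      rexp (π * (1 - mu) ^ 2 / 4 * s) := by
    rw [← exp_add, ← exp_add]
    congr 1
    ring
  rw [← hexp]
  field_simp
end

section
/- Let μ ∈ (0,1) and k ∈ (0,1), and define f(λ) := Θ((μ−λ)K(k), k)/Θ((μ+λ)K(k), k). Then f is a convex function of λ on (0,1), and f(0) = f(1) = 1. -/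
open Real

/-- The Gaussian sum `∑ₙ εⁿ exp(-π (n + x)² s)` over the integers. -/
noncomputable def latticeGaussian (ε s x : ℝ) : ℝ :=
  ∑' n : ℤ, ε ^ n * Real.exp (-π * (n + x) ^ 2 * s)

lemma latticeGaussian_one_eq_evenKernel {s : ℝ} (hs : 0 < s) (x : ℝ) :
    latticeGaussian 1 s x = HurwitzZeta.evenKernel x s := by
  simp only [latticeGaussian, one_zpow, one_mul]
  exact (HurwitzZeta.hasSum_int_evenKernel x hs).tsum_eq

lemma summable_gaussian {s : ℝ} (hs : 0 < s) (x : ℝ) :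
    Summable fun n : ℤ => Real.exp (-π * (n + x) ^ 2 * s) :=
  (HurwitzZeta.hasSum_int_evenKernel x hs).summable

lemma summable_norm_latticeGaussian {ε s : ℝ} (hε : |ε| = 1) (hs : 0 < s) (x : ℝ) :
    Summable fun n : ℤ => ‖ε ^ n * Real.exp (-π * (n + x) ^ 2 * s)‖ := by
  simpa [abs_zpow, hε] using summable_gaussian hs x

/-- Pairs of integers, split by the parity of their sum. -/
noncomputable def parityEquiv : (ℤ × ℤ) ⊕ (ℤ × ℤ) ≃ ℤ × ℤ :=
  Equiv.ofBijective
    (Sum.elim (fun p => (p.1 + p.2, p.1 - p.2)) (fun p => (p.1 + p.2 + 1, p.1 - p.2))) <| by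
    constructor
    · rintro (⟨a, b⟩ | ⟨a, b⟩) (⟨c, d⟩ | ⟨c, d⟩) h <;>
        simp only [Sum.elim_inl, Sum.elim_inr, Prod.mk.injEq, Sum.inl.injEq, Sum.inr.injEq,
          reduceCtorEq] at h ⊢ <;> omega
    · rintro ⟨m, n⟩
      rcases Int.even_or_odd' (m + n) with ⟨j, hj | hj⟩
      · exact ⟨Sum.inl (j, m - j), by simp; omega⟩
      · exact ⟨Sum.inr (j, m - j - 1), by simp; omega⟩

/-- The product of two Gaussian sums as a double sum. -/
lemma hasSum_latticeGaussian_mul {ε s : ℝ} (hε : |ε| = 1) (hs : 0 < s) (x y : ℝ) :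
    HasSum (fun p : ℤ × ℤ => (ε ^ p.1 * Real.exp (-π * (p.1 + x) ^ 2 * s)) *
      (ε ^ p.2 * Real.exp (-π * (p.2 + y) ^ 2 * s)))
      (latticeGaussian ε s x * latticeGaussian ε s y) :=
  (summable_norm_latticeGaussian hε hs x).of_norm.hasSum.mul
    (summable_norm_latticeGaussian hε hs y).of_norm.hasSum
    (summable_mul_of_summable_norm (summable_norm_latticeGaussian hε hs x)
      (summable_norm_latticeGaussian hε hs y))

/-- The addition formula for Gaussian sums. -/
lemma latticeGaussian_add_mul_latticeGaussian_sub {ε s : ℝ} (hε : |ε| = 1) (hs : 0 < s)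
    (x y : ℝ) :
    latticeGaussian ε s (x + y) * latticeGaussian ε s (x - y) =
      latticeGaussian 1 (2 * s) x * latticeGaussian 1 (2 * s) y +
        ε * (latticeGaussian 1 (2 * s) (x + 1 / 2) * latticeGaussian 1 (2 * s) (y + 1 / 2)) := by
  have h2s : 0 < 2 * s := by positivity
  have hε0 : ε ≠ 0 := by rintro rfl; simp at hε
  have hεε : ε * ε = 1 := by rw [← abs_mul_abs_self, hε, one_mul]
  have hpow (j : ℤ) : ε ^ (2 * j) = 1 := by
    rw [zpow_mul, zpow_two, hεε, one_zpow]
  set F : ℤ × ℤ → ℝ := fun p => (ε ^ p.1 * Real.exp (-π * (p.1 + (x + y)) ^ 2 * s)) *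
    (ε ^ p.2 * Real.exp (-π * (p.2 + (x - y)) ^ 2 * s)) with hF
  have hprod : HasSum F (latticeGaussian ε s (x + y) * latticeGaussian ε s (x - y)) :=
    hasSum_latticeGaussian_mul hε hs (x + y) (x - y)
  have heven := hasSum_latticeGaussian_mul abs_one h2s x y
  have hodd := (hasSum_latticeGaussian_mul abs_one h2s (x + 1 / 2) (y + 1 / 2)).mul_left ε
  simp only [one_zpow, one_mul] at heven hodd
  refine (parityEquiv.hasSum_iff.2 hprod).unique (HasSum.sum ?_ ?_)
  · refine Eq.mpr (congrArg (HasSum · _) (funext fun p => ?_)) heven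
    change F (p.1 + p.2, p.1 - p.2) = _
    simp only [hF]
    rw [mul_mul_mul_comm, ← zpow_add₀ hε0, ← exp_add, ← exp_add,
      show p.1 + p.2 + (p.1 - p.2) = 2 * p.1 by ring, hpow, one_mul]
    push_cast
    ring_nf
  · refine Eq.mpr (congrArg (HasSum · _) (funext fun p => ?_)) hodd
    change F (p.1 + p.2 + 1, p.1 - p.2) = _
    simp only [hF]
    rw [mul_mul_mul_comm, ← zpow_add₀ hε0, ← exp_add, ← exp_add,
      show p.1 + p.2 + 1 + (p.1 - p.2) = 2 * p.1 + 1 by ring, zpow_add₀ hε0, hpow, one_mul,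
      zpow_one]
    push_cast
    ring_nf

lemma latticeGaussian_one_pos {s : ℝ} (hs : 0 < s) (x : ℝ) : 0 < latticeGaussian 1 s x := by
  simp only [latticeGaussian, one_zpow, one_mul]
  exact (summable_gaussian hs x).tsum_pos (fun _ => (exp_pos _).le) 0 (exp_pos _)

lemma latticeGaussian_one_add_one {s : ℝ} (hs : 0 < s) (x : ℝ) :
    latticeGaussian 1 s (x + 1) = latticeGaussian 1 s x := by
  rw [latticeGaussian_one_eq_evenKernel hs, latticeGaussian_one_eq_evenKernel hs]
  simp

lemma latticeGaussian_one_neg {s : ℝ} (hs : 0 < s) (x : ℝ) :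
    latticeGaussian 1 s (-x) = latticeGaussian 1 s x := by
  rw [latticeGaussian_one_eq_evenKernel hs, latticeGaussian_one_eq_evenKernel hs]
  simp

open Complex in
lemma continuous_latticeGaussian_one {s : ℝ} (hs : 0 < s) : Continuous (latticeGaussian 1 s) := by
  have h : Continuous fun x : ℝ =>
      (cexp (-π * x ^ 2 * s) * jacobiTheta₂ (x * I * s) (I * s)).re := by
    refine continuous_re.comp (.mul (by fun_prop) ?_)
    exact continuous_iff_continuousAt.2 fun x =>
      ContinuousAt.comp (f := fun x : ℝ => (x * I * s : ℂ))
        (g := fun z => jacobiTheta₂ z (I * s))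
        (differentiableAt_jacobiTheta₂_fst _ (by simpa)).continuousAt (by fun_prop)
  convert h using 2 with x
  rw [latticeGaussian_one_eq_evenKernel hs, ← HurwitzZeta.evenKernel_def, ofReal_re]

/-- The Gaussian sum attains its maximum only at the lattice points. -/
lemma latticeGaussian_one_lt_zero {s x : ℝ} (hs : 0 < s) (hx : x ∈ Set.Ioo (0 : ℝ) 1) :
    latticeGaussian 1 s x < latticeGaussian 1 s 0 := by
  have hs' : 0 < 1 / s := by positivity
  rw [latticeGaussian_one_eq_evenKernel hs, latticeGaussian_one_eq_evenKernel hs,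
    HurwitzZeta.evenKernel_functional_equation, HurwitzZeta.evenKernel_functional_equation]
  refine mul_lt_mul_of_pos_left ?_ (by positivity)
  rw [← sub_lt_sub_iff_right 1]
  refine hasSum_lt (i := 0) (fun n => ?_) ?_ (HurwitzZeta.hasSum_nat_cosKernel₀ x hs')
    (HurwitzZeta.hasSum_nat_cosKernel₀ 0 hs')
  · simp only [mul_zero, zero_mul, cos_zero]
    gcongr
    exact cos_le_one _
  · simp only [mul_zero, zero_mul, cos_zero]
    gcongr
    refine lt_of_le_of_ne (cos_le_one _) fun h => ?_
    rw [cos_eq_one_iff_of_lt_of_lt] at h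
    · have := hx.1; have := pi_pos; simp at h; grind
    · have := hx.1; have := pi_pos; simp; nlinarith
    · have := hx.2; have := pi_pos; simp; nlinarith

lemma latticeGaussian_half_shift_mul {s : ℝ} (hs : 0 < s) (x y : ℝ) :
    latticeGaussian 1 s (x + y + 1 / 2) * latticeGaussian 1 s (x - y + 1 / 2) =
      latticeGaussian 1 (2 * s) (x + 1 / 2) * latticeGaussian 1 (2 * s) y +
        latticeGaussian 1 (2 * s) x * latticeGaussian 1 (2 * s) (y + 1 / 2) := by
  have h := latticeGaussian_add_mul_latticeGaussian_sub abs_one hs (x + 1 / 2) y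
  rwa [one_mul, show x + 1 / 2 + 1 / 2 = x + 1 by ring,
    latticeGaussian_one_add_one (by positivity), show x + 1 / 2 + y = x + y + 1 / 2 by ring,
    show x + 1 / 2 - y = x - y + 1 / 2 by ring] at h

/-- The bilinear form in lattice Gaussians that factors through alternating sums. -/
noncomputable def latticeWronskian (s x y : ℝ) : ℝ :=
  latticeGaussian 1 s (x + 1 / 2) * latticeGaussian 1 s y -
    latticeGaussian 1 s x * latticeGaussian 1 s (y + 1 / 2)

lemma latticeWronskian_eq_mul {s : ℝ} (hs : 0 < s) (x y : ℝ) :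
    latticeWronskian (2 * s) x y =
      latticeGaussian (-1) s (x + y + 1 / 2) * latticeGaussian (-1) s (x - y + 1 / 2) := by
  have h := latticeGaussian_add_mul_latticeGaussian_sub (ε := -1) (by simp) hs (x + 1 / 2) y
  rw [show x + 1 / 2 + 1 / 2 = x + 1 by ring,
    latticeGaussian_one_add_one (by positivity), show x + 1 / 2 + y = x + y + 1 / 2 by ring,
    show x + 1 / 2 - y = x - y + 1 / 2 by ring] at h
  rw [h, latticeWronskian]
  ring

lemma exists_isMinOn_latticeGaussian_one {s : ℝ} (hs : 0 < s) :
    ∃ u, ∀ x, latticeGaussian 1 s u ≤ latticeGaussian 1 s x := by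
  obtain ⟨u, -, hu⟩ := isCompact_Icc.exists_isMinOn (Set.nonempty_Icc.2 zero_le_one)
    (continuous_latticeGaussian_one hs).continuousOn
  refine ⟨u, fun x => ?_⟩
  obtain ⟨y, hy, hxy⟩ := Function.Periodic.exists_mem_Ico₀
    (f := latticeGaussian 1 s) (latticeGaussian_one_add_one hs) one_pos x
  rw [hxy]
  exact hu (Set.Ico_subset_Icc_self hy)

/-- The alternating Gaussian sum has no zeros strictly between consecutive half-integers. -/
lemma latticeGaussian_neg_one_ne_zero {s z : ℝ} (hs : 0 < s) (hz : z ∈ Set.Ioo (0 : ℝ) 1) :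
    latticeGaussian (-1) s (z + 1 / 2) ≠ 0 := by
  intro h0
  have h2s : 0 < 2 * s := by positivity
  have hW : latticeWronskian (2 * s) z 0 = 0 := by
    rw [latticeWronskian_eq_mul hs, add_zero, h0, zero_mul]
  have hA := latticeGaussian_one_pos h2s 0
  obtain ⟨κ, hκ⟩ : ∃ κ, latticeGaussian 1 (2 * s) z = κ * latticeGaussian 1 (2 * s) 0 :=
    ⟨_, (div_mul_cancel₀ _ hA.ne').symm⟩
  have hκ' : latticeGaussian 1 (2 * s) (z + 1 / 2) =
      κ * latticeGaussian 1 (2 * s) (0 + 1 / 2) := by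
    rw [latticeWronskian, hκ] at hW
    exact mul_right_cancel₀ hA.ne' (by linear_combination hW)
  have hmul (u : ℝ) : latticeGaussian 1 s (u + z + 1 / 2) * latticeGaussian 1 s (u - z + 1 / 2) =
      κ * latticeGaussian 1 s (u + 1 / 2) ^ 2 := by
    have h := latticeGaussian_half_shift_mul hs u 0
    rw [add_zero, sub_zero] at h
    rw [latticeGaussian_half_shift_mul hs, hκ, hκ', sq, h]
    ring
  have hmax : κ < 1 := by
    have h := hmul (-1 / 2)
    rw [show -1 / 2 + z + 1 / 2 = z by ring, show -1 / 2 - z + 1 / 2 = -z by ring,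
      latticeGaussian_one_neg hs, show (-1 / 2 + 1 / 2 : ℝ) = 0 by norm_num] at h
    nlinarith [latticeGaussian_one_lt_zero hs hz, latticeGaussian_one_pos hs z]
  obtain ⟨u, hu⟩ := exists_isMinOn_latticeGaussian_one hs
  have h := hmul (u - 1 / 2)
  rw [sub_add_cancel] at h
  have hpos := latticeGaussian_one_pos hs u
  have := mul_le_mul (hu (u - 1 / 2 + z + 1 / 2)) (hu (u - 1 / 2 - z + 1 / 2)) hpos.le
    (latticeGaussian_one_pos hs _).le
  nlinarith [mul_pos hpos hpos]

lemma latticeWronskian_pos {s x y : ℝ} (hs : 0 < s) (hadd : x + y ∈ Set.Ioo (0 : ℝ) 1)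
    (hsub : x - y ∈ Set.Ioo (0 : ℝ) 1) : 0 < latticeWronskian (2 * s) x y := by
  have hc := continuous_latticeGaussian_one (s := 2 * s) (by positivity)
  set φ : ℝ → ℝ := fun q => latticeWronskian (2 * s) ((x + y + q) / 2) ((x + y - q) / 2)
  have hφc : Continuous φ := by
    simp only [φ, latticeWronskian]
    fun_prop
  have hφ (q : ℝ) : φ q = latticeGaussian (-1) s (x + y + 1 / 2) *
      latticeGaussian (-1) s (q + 1 / 2) := by
    simp only [φ]
    rw [latticeWronskian_eq_mul hs]
    ring_nf
  have hne : ∀ q ∈ Set.Ioo (0 : ℝ) 1, φ q ≠ 0 := fun q hq => by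
    rw [hφ]
    exact mul_ne_zero (latticeGaussian_neg_one_ne_zero hs hadd)
      (latticeGaussian_neg_one_ne_zero hs hq)
  have hpos : 0 < φ (x + y) := by
    rw [hφ]
    exact mul_self_pos.2 (latticeGaussian_neg_one_ne_zero hs hadd)
  suffices 0 < φ (x - y) by
    rw [hφ] at this
    rwa [latticeWronskian_eq_mul hs]
  by_contra! hle
  obtain ⟨q, hq, hq0⟩ := isPreconnected_Ioo.intermediate_value hsub hadd hφc.continuousOn
    ⟨hle, hpos.le⟩
  exact hne q hq hq0

/-- Strict midpoint log-convexity of the quotient of two shifted lattice Gaussians. -/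
lemma latticeGaussian_quotient_midpoint {s a b h : ℝ} (hs : 0 < s)
    (hadd : b + a ∈ Set.Ioo (0 : ℝ) 1) (hsub : b - a ∈ Set.Ioo (0 : ℝ) 1)
    (hh : h ∈ Set.Ioo (0 : ℝ) 1) :
    latticeGaussian 1 s (b + h + 1 / 2) * latticeGaussian 1 s (b - h + 1 / 2) *
        latticeGaussian 1 s (a + 1 / 2) ^ 2 <
      latticeGaussian 1 s (a + h + 1 / 2) * latticeGaussian 1 s (a - h + 1 / 2) *
        latticeGaussian 1 s (b + 1 / 2) ^ 2 := by
  have hsq (u : ℝ) := latticeGaussian_half_shift_mul hs u 0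
  simp only [add_zero, sub_zero] at hsq
  rw [sq, sq, hsq, hsq, latticeGaussian_half_shift_mul hs, latticeGaussian_half_shift_mul hs]
  have hW := mul_pos (latticeWronskian_pos (x := h) (y := 0) hs (by simpa) (by simpa))
    (latticeWronskian_pos hs hadd hsub)
  rw [latticeWronskian, latticeWronskian] at hW
  linarith

/-- A continuous strictly midpoint-convex function on an interval is convex. -/
lemma convexOn_Ioo_of_midpoint {f : ℝ → ℝ} {p r : ℝ} (hf : ContinuousOn f (Set.Ioo p r))
    (hmid : ∀ c h, 0 < h → c - h ∈ Set.Ioo p r → c + h ∈ Set.Ioo p r →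
      2 * f c < f (c - h) + f (c + h)) :
    ConvexOn ℝ (Set.Ioo p r) f := by
  refine LinearOrder.convexOn_of_lt (convex_Ioo p r) fun x hx y hy hxy a b ha hb hab => ?_
  simp only [smul_eq_mul]
  by_contra! hlt
  have hsubset : Set.Icc x y ⊆ Set.Ioo p r := Set.Icc_subset_Ioo hx.1 hy.2
  obtain ⟨m, hm⟩ : ∃ m, f y = f x + m * (y - x) :=
    ⟨(f y - f x) / (y - x), by rw [div_mul_cancel₀ _ (sub_pos.2 hxy).ne']; ring⟩
  set φ : ℝ → ℝ := fun w => f w - (f x + m * (w - x)) with hφ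
  obtain ⟨c, hc, hmax⟩ := isCompact_Icc.exists_isMaxOn (Set.nonempty_Icc.2 hxy.le)
    (show ContinuousOn φ (Set.Icc x y) from (hf.mono hsubset).sub (by fun_prop))
  have hz : a * x + b * y ∈ Set.Icc x y :=
    convex_Icc x y (Set.left_mem_Icc.2 hxy.le) (Set.right_mem_Icc.2 hxy.le) ha.le hb.le hab
  have hcpos : 0 < φ c := by
    refine lt_of_lt_of_le ?_ (hmax hz)
    obtain rfl : a = 1 - b := by linarith
    simp only [hφ]
    rw [hm] at hlt
    linarith
  have hxc : x < c := lt_of_le_of_ne hc.1 (by rintro rfl; simp [hφ] at hcpos)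
  have hcy : c < y := lt_of_le_of_ne hc.2 (by rintro rfl; simp [hφ, hm] at hcpos)
  have hh : 0 < min (c - x) (y - c) := lt_min (by linarith) (by linarith)
  have hh₁ := min_le_left (c - x) (y - c)
  have hh₂ := min_le_right (c - x) (y - c)
  generalize min (c - x) (y - c) = h at hh hh₁ hh₂
  have hl : c - h ∈ Set.Icc x y := ⟨by linarith, by linarith⟩
  have hr : c + h ∈ Set.Icc x y := ⟨by linarith, by linarith⟩
  have h₁ : φ (c - h) ≤ φ c := hmax hl
  have h₂ : φ (c + h) ≤ φ c := hmax hr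
  have := hmid c h hh (hsubset hl) (hsubset hr)
  simp only [hφ] at h₁ h₂
  linarith

lemma EllK_pos {k : ℝ} (hk : k ^ 2 < 1) : 0 < EllK k := by
  have hpos (θ : ℝ) : 0 < 1 - k ^ 2 * sin θ ^ 2 := by
    nlinarith [sin_sq_le_one θ, sq_nonneg k, sq_nonneg (sin θ)]
  refine intervalIntegral.intervalIntegral_pos_of_pos_on ?_ (fun θ _ => ?_) (by positivity)
  · refine Continuous.intervalIntegrable ?_ _ _
    exact continuous_const.div (by fun_prop) fun θ => (sqrt_pos.2 (hpos θ)).ne'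
  · exact one_div_pos.2 (sqrt_pos.2 (hpos θ))

/-- The Poisson summation form of Jacobi's theta function. -/
lemma JTheta_eq_latticeGaussian {k : ℝ} (hk : k ∈ Set.Ioo (0 : ℝ) 1) :
    ∃ s C : ℝ, 0 < s ∧ 0 < C ∧
      ∀ t, JTheta (t * EllK k) k = C * latticeGaussian 1 s (t / 2 + 1 / 2) := by
  have hK : 0 < EllK k := EllK_pos (by nlinarith [hk.1, hk.2])
  have hK' : 0 < EllK' k := EllK_pos (by
    rw [sq_sqrt (by nlinarith [hk.1, hk.2])]; nlinarith [hk.1])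
  set r := EllK' k / EllK k with hr
  have hr0 : 0 < r := div_pos hK' hK
  have hs : 0 < 1 / r := by positivity
  refine ⟨1 / r, (1 / r) ^ (1 / 2 : ℝ), hs, by positivity, fun t => ?_⟩
  rw [latticeGaussian_one_eq_evenKernel hs, HurwitzZeta.evenKernel_functional_equation,
    one_div_one_div, ← mul_assoc, mul_one_div_cancel (by positivity), one_mul,
    sub_eq_iff_eq_add'.1 (HurwitzZeta.hasSum_nat_cosKernel₀ (t / 2 + 1 / 2) hr0).tsum_eq.symm,
    JTheta, ← tsum_mul_left]
  congr 1
  refine tsum_congr fun n => ?_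
  have hcos : cos (2 * π * (t / 2 + 1 / 2) * (n + 1)) =
      (-1) ^ (n + 1) * cos ((n + 1) * π * (t * EllK k) / EllK k) := by
    rw [← cos_add_nat_mul_pi]
    congr 1
    push_cast
    field_simp
  have hnome : nome k ^ ((n + 1) ^ 2) = Real.exp (-π * (n + 1) ^ 2 * r) := by
    rw [nome, ← Real.exp_nat_mul, hr]
    congr 1
    push_cast
    ring
  rw [hcos, hnome]
  ring

theorem stmt_5 (mu k : ℝ) (hmu : mu ∈ Set.Ioo (0:ℝ) 1) (hk : k ∈ Set.Ioo (0:ℝ) 1) :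
    ConvexOn ℝ (Set.Ioo (0:ℝ) 1)
      (fun lam => JTheta ((mu - lam) * EllK k) k / JTheta ((mu + lam) * EllK k) k) ∧
    JTheta ((mu - 0) * EllK k) k / JTheta ((mu + 0) * EllK k) k = 1 ∧
    JTheta ((mu - 1) * EllK k) k / JTheta ((mu + 1) * EllK k) k = 1 := by
  obtain ⟨s, C, hs, hC, hJ⟩ := JTheta_eq_latticeGaussian hk
  have hpos := latticeGaussian_one_pos hs
  have hcont := continuous_latticeGaussian_one hs
  simp only [hJ, mul_div_mul_left _ _ hC.ne']
  refine ⟨convexOn_Ioo_of_midpoint ?_ fun c h hh hl hr => ?_, ?_, ?_⟩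
  · exact ContinuousOn.div (by fun_prop) (by fun_prop) fun _ _ => (hpos _).ne'
  · have key := latticeGaussian_quotient_midpoint (a := (mu - c) / 2) (b := (mu + c) / 2)
      (h := h / 2) hs ⟨by linarith [hmu.1], by linarith [hmu.2]⟩
      ⟨by linarith [hl.1], by linarith [hr.2]⟩ ⟨by linarith, by linarith [hl.1, hr.2]⟩
    rw [show (mu + c) / 2 + h / 2 + 1 / 2 = (mu + (c + h)) / 2 + 1 / 2 by ring,
      show (mu + c) / 2 - h / 2 + 1 / 2 = (mu + (c - h)) / 2 + 1 / 2 by ring,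
      show (mu - c) / 2 + h / 2 + 1 / 2 = (mu - (c - h)) / 2 + 1 / 2 by ring,
      show (mu - c) / 2 - h / 2 + 1 / 2 = (mu - (c + h)) / 2 + 1 / 2 by ring] at key
    have hlog : (latticeGaussian 1 s ((mu - c) / 2 + 1 / 2) /
        latticeGaussian 1 s ((mu + c) / 2 + 1 / 2)) ^ 2 <
        latticeGaussian 1 s ((mu - (c - h)) / 2 + 1 / 2) /
          latticeGaussian 1 s ((mu + (c - h)) / 2 + 1 / 2) *
        (latticeGaussian 1 s ((mu - (c + h)) / 2 + 1 / 2) /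
          latticeGaussian 1 s ((mu + (c + h)) / 2 + 1 / 2)) := by
      rw [div_pow, div_mul_div_comm,
        div_lt_div_iff₀ (pow_pos (hpos _) 2) (mul_pos (hpos _) (hpos _))]
      linarith
    have hq (x y : ℝ) := div_pos (hpos x) (hpos y)
    refine lt_of_pow_lt_pow_left₀ 2 (add_pos (hq _ _) (hq _ _)).le ?_
    linarith [four_mul_le_sq_add (latticeGaussian 1 s ((mu - (c - h)) / 2 + 1 / 2) /
          latticeGaussian 1 s ((mu + (c - h)) / 2 + 1 / 2))
        (latticeGaussian 1 s ((mu - (c + h)) / 2 + 1 / 2) /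
          latticeGaussian 1 s ((mu + (c + h)) / 2 + 1 / 2))]
  · rw [sub_zero, add_zero, div_self (hpos _).ne']
  · rw [show (mu + 1) / 2 + 1 / 2 = (mu - 1) / 2 + 1 / 2 + 1 by ring,
      latticeGaussian_one_add_one hs, div_self (hpos _).ne']
end
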